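/- arXiv:1001.2840 — 5 statements merged into one kernel-verified Lean document; each statement's English description precedes it below -/
import Mathlib

section
/- Let f : ℝ → ℝ be twice continuously differentiable with f''(u) ≠ 0 for all u, and let s(u, v) = (f(u) - f(v))/(u - v) for u ≠ v, s(u, u) = f'(u). Fix real numbers x₋, x, x₊ with x₋ < x < x₊, fixed neighbor values a and b, and a value u. Then as (u⁻, u⁺) → (u, u), the right-hand side of the shock-particle equations of motion converges to that of the characteristic equations; precisely: s(u⁻, u⁺) → f'(u), (s(u⁻, u⁺) - f'(u⁻))·(f'(a) - f'(u⁻))/((x₋ - x)·f''(u⁻)) → 0, and (s(u⁻, u⁺) - f'(u⁺))·(f'(b) - f'(u⁺))/((x₊ - x)·f''(u⁺)) → 0. -/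
open Filter Topology

/-- The Rankine–Hugoniot shock speed: the difference quotient of the flux `f`,
continuously extended by `f'(u)` on the diagonal. -/
noncomputable def shockSpeed (f : ℝ → ℝ) (u v : ℝ) : ℝ :=
  if u = v then deriv f u else (f u - f v) / (u - v)

/-- The shock speed is continuous at the diagonal, by strict differentiability. -/
theorem tendsto_shockSpeed {f : ℝ → ℝ} {u : ℝ}
    (hf : HasStrictDerivAt f (deriv f u) u) (hf' : ContinuousAt (deriv f) u) :
    Tendsto (fun p : ℝ × ℝ => shockSpeed f p.1 p.2) (𝓝 (u, u)) (𝓝 (deriv f u)) := by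
  have hquot := hasDerivAtFilter_iff_isLittleO.mp hf
  rw [Metric.tendsto_nhds]
  intro ε hε
  have hdiag : ∀ᶠ p : ℝ × ℝ in 𝓝 (u, u), dist (deriv f p.1) (deriv f u) < ε :=
    (hf'.tendsto.comp (continuous_fst.tendsto (u, u))).eventually (Metric.ball_mem_nhds _ hε)
  filter_upwards [hquot.def (half_pos hε), hdiag] with p hp hp'
  unfold shockSpeed
  split_ifs with h
  · exact hp'
  · have hne : p.1 - p.2 ≠ 0 := sub_ne_zero.mpr h
    have hpos : 0 < |p.1 - p.2| := abs_pos.mpr hne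
    rw [Real.dist_eq, div_sub' hne, abs_div, div_lt_iff₀ hpos]
    simp only [Real.norm_eq_abs, smul_eq_mul] at hp
    exact hp.trans_lt (mul_lt_mul_of_pos_right (half_lt_self hε) hpos)

/-- A state rate of change vanishes in the limit, as its coefficient stays bounded. -/
theorem tendsto_shockSpeed_sub_mul_zero {f : ℝ → ℝ} (hf : ContDiff ℝ 2 f)
    {u d : ℝ} (hu : deriv (deriv f) u ≠ 0) (hd : d ≠ 0) (c : ℝ)
    {π : ℝ × ℝ → ℝ} (hπ : Tendsto π (𝓝 (u, u)) (𝓝 u)) :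
    Tendsto (fun p : ℝ × ℝ =>
        (shockSpeed f p.1 p.2 - deriv f (π p)) *
          ((c - deriv f (π p)) / (d * deriv (deriv f) (π p))))
      (𝓝 (u, u)) (𝓝 0) := by
  have hf1 : ContDiff ℝ 1 (deriv f) := ContDiff.deriv' (n := 1) hf
  have h1 : Continuous (deriv f) := hf1.continuous
  have h2 : Continuous (deriv (deriv f)) := hf1.continuous_deriv le_rfl
  have hs := tendsto_shockSpeed (hf.hasStrictDerivAt (x := u) two_ne_zero) h1.continuousAt
  have hπ1 := (h1.tendsto u).comp hπ
  have hπ2 := (h2.tendsto u).comp hπ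
  have h := (hs.sub hπ1).mul
    ((hπ1.const_sub c).div (hπ2.const_mul d) (mul_ne_zero hd hu))
  rwa [sub_self, zero_mul] at h

/-- Lemma 3.1 of the paper. As `(u⁻, u⁺) → (u, u)`, the
right-hand side of the shock-particle equations of motion converges to that of
the characteristic equations: `s(u⁻, u⁺) → f'(u)` and the rates of change of
the left and right states tend to `0`. -/
theorem shock_particle_reduces_to_characteristic
    (f : ℝ → ℝ) (hf : ContDiff ℝ 2 f) (hf'' : ∀ u, deriv (deriv f) u ≠ 0)
    (xm x xp : ℝ) (hxm : xm < x) (hxp : x < xp) (a b u : ℝ) :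
    Tendsto (fun p : ℝ × ℝ => shockSpeed f p.1 p.2) (𝓝 (u, u))
       (𝓝 (deriv f u)) ∧
    Tendsto (fun p : ℝ × ℝ =>
        (shockSpeed f p.1 p.2 - deriv f p.1) *
          ((deriv f a - deriv f p.1) / ((xm - x) * deriv (deriv f) p.1)))
      (𝓝 (u, u)) (𝓝 0) ∧
    Tendsto (fun p : ℝ × ℝ =>
        (shockSpeed f p.1 p.2 - deriv f p.2) *
          ((deriv f b - deriv f p.2) / ((xp - x) * deriv (deriv f) p.2)))
      (𝓝 (u, u)) (𝓝 0) := by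
  exact ⟨tendsto_shockSpeed (hf.hasStrictDerivAt two_ne_zero)
      (hf.continuous_deriv one_le_two).continuousAt,
    tendsto_shockSpeed_sub_mul_zero hf (hf'' u) (sub_neg.mpr hxm).ne _
      (continuous_fst.tendsto (u, u)),
    tendsto_shockSpeed_sub_mul_zero hf (hf'' u) (sub_pos.mpr hxp).ne' _
      (continuous_snd.tendsto (u, u))⟩
end

section
/- Let f : ℝ → ℝ be twice continuously differentiable with f''(u) > 0 for all u. Let x₁, v, x₂, w be differentiable real-valued functions on an open time interval J with x₁(t) < x₂(t) and v(t) ≠ w(t) for all t ∈ J, satisfying v'(t) = (x₁'(t) - f'(v(t)))·(f'(w(t)) - f'(v(t)))/((x₂(t) - x₁(t))·f''(v(t))) and w'(t) = (x₂'(t) - f'(w(t)))·(f'(v(t)) - f'(w(t)))/((x₁(t) - x₂(t))·f''(w(t))). For t ∈ J and x₁(t) < x < x₂(t), define U(x, t) as the unique value between v(t) and w(t) with (x - x₁(t))/(x₂(t) - x₁(t)) = (f'(U(x,t)) - f'(v(t)))/(f'(w(t)) - f'(v(t))). Then U is continuously differentiable on {(x, t) : t ∈ J, x₁(t) < x < x₂(t)}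 and satisfies ∂U/∂t + f'(U)·∂U/∂x = 0 there. -/
open Set

/-- A function with a continuous derivative on an open set is continuously differentiable there. -/
theorem contDiffOn_one_of_hasDerivAt {q q' : ℝ → ℝ} {s : Set ℝ} (hs : IsOpen s)
    (hq : ∀ t ∈ s, HasDerivAt q (q' t) t) (hq' : ContinuousOn q' s) : ContDiffOn ℝ 1 q s := by
  rw [show (1 : WithTop ℕ∞) = 0 + 1 from (zero_add 1).symm,
    contDiffOn_succ_iff_deriv_of_isOpen hs]
  refine ⟨fun t ht => (hq t ht).differentiableAt.differentiableWithinAt, by simp, ?_⟩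
  rw [contDiffOn_zero]
  exact hq'.congr fun t ht => (hq t ht).deriv

/-- If `F` is `C¹`, injective, with nonvanishing derivative, then any function `U` for which
`F ∘ U` is `C¹` at a point is itself `C¹` there. -/
theorem contDiffAt_of_comp_eventuallyEq {E : Type*} [NormedAddCommGroup E] [NormedSpace ℝ E]
    {F : ℝ → ℝ} (hF : ContDiff ℝ 1 F) (hinj : Function.Injective F) {U g : E → ℝ} {p : E}
    (hF' : deriv F (U p) ≠ 0) (hg : ContDiffAt ℝ 1 g p) (hUg : ∀ᶠ z in nhds p, F (U z) = g z) :
    ContDiffAt ℝ 1 U p := by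
  have hFd : HasFDerivAt F
      (ContinuousLinearEquiv.unitsEquivAut ℝ (Units.mk0 _ hF') : ℝ →L[ℝ] ℝ) (U p) := by
    have h := ((hF.differentiable one_ne_zero) (U p)).hasDerivAt.hasFDerivAt
    have heq : (ContinuousLinearEquiv.unitsEquivAut ℝ (Units.mk0 _ hF') : ℝ →L[ℝ] ℝ) =
        ContinuousLinearMap.toSpanSingleton ℝ (deriv F (U p)) := by
      ext
      simp
    rw [heq]
    exact h
  have hFs := hF.contDiffAt.hasStrictFDerivAt' (x := U p) hFd one_ne_zero
  have hp : F (U p) = g p := hUg.self_of_nhds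
  have hloc : ContDiffAt ℝ 1 (hFs.localInverse F _ (U p)) (g p) := by
    rw [← hp]
    exact hF.contDiffAt.to_localInverse hFd one_ne_zero
  refine (hloc.comp p hg).congr_of_eventuallyEq ?_
  have hright : ∀ᶠ z in nhds p, F (hFs.localInverse F _ (U p) (g z)) = g z := by
    have h := hFs.eventually_right_inverse
    rw [hp] at h
    exact hg.continuousAt.eventually h
  filter_upwards [hUg, hright] with z h₁ h₂
  exact hinj (h₁.trans h₂.symm)

/-- Between two shock particles whose adjacent states `v`, `w`
evolve according to the shock-particle equations of motion, the similarity
interpolant remains a classical solution of the conservation law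
`u_t + f'(u)·u_x = 0`, whatever the particle velocities `x₁'`, `x₂'` are. -/
theorem interpolant_between_shock_particles_solves_pde
    (f : ℝ → ℝ) (hf : ContDiff ℝ 2 f) (hconv : ∀ u, 0 < deriv (deriv f) u)
    (t₀ t₁ : ℝ) (x₁ x₂ v w : ℝ → ℝ)
    (hx₁ : ∀ t ∈ Ioo t₀ t₁, DifferentiableAt ℝ x₁ t)
    (hx₂ : ∀ t ∈ Ioo t₀ t₁, DifferentiableAt ℝ x₂ t)
    (hord : ∀ t ∈ Ioo t₀ t₁, x₁ t < x₂ t)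
    (hvw : ∀ t ∈ Ioo t₀ t₁, v t ≠ w t)
    (hv : ∀ t ∈ Ioo t₀ t₁,
      HasDerivAt v
        ((deriv x₁ t - deriv f (v t)) * (deriv f (w t) - deriv f (v t)) /
          ((x₂ t - x₁ t) * deriv (deriv f) (v t))) t)
    (hw : ∀ t ∈ Ioo t₀ t₁,
      HasDerivAt w
        ((deriv x₂ t - deriv f (w t)) * (deriv f (v t) - deriv f (w t)) /
          ((x₁ t - x₂ t) * deriv (deriv f) (w t))) t)
    (U : ℝ → ℝ → ℝ)
    (hU : ∀ t ∈ Ioo t₀ t₁, ∀ x : ℝ, x₁ t < x → x < x₂ t →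
      U x t ∈ uIcc (v t) (w t) ∧
        (x - x₁ t) / (x₂ t - x₁ t) =
          (deriv f (U x t) - deriv f (v t)) / (deriv f (w t) - deriv f (v t))) :
    ContDiffOn ℝ 1 (fun p : ℝ × ℝ => U p.1 p.2)
      {p : ℝ × ℝ | p.2 ∈ Ioo t₀ t₁ ∧ x₁ p.2 < p.1 ∧ p.1 < x₂ p.2} ∧
    ∀ t ∈ Ioo t₀ t₁, ∀ x : ℝ, x₁ t < x → x < x₂ t →
      deriv (fun s => U x s) t + deriv f (U x t) * deriv (fun y => U y t) x = 0 := by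
  set F := deriv f with hFdef
  have hF : ContDiff ℝ 1 F := by
    have h : ContDiff ℝ (1 + 1) f := by simpa [one_add_one_eq_two] using hf
    exact (contDiff_succ_iff_deriv.1 h).2.2
  have hmono : StrictMono F := strictMono_of_deriv_pos hconv
  have hFderiv : ∀ u, HasDerivAt F (deriv F u) u := fun u =>
    ((hF.differentiable one_ne_zero) u).hasDerivAt
  -- on each slice, `F (U x t)` is the affine function `q t * x + r t`
  let q : ℝ → ℝ := fun t => (F (w t) - F (v t)) / (x₂ t - x₁ t)
  let r : ℝ → ℝ := fun t => F (v t) - q t * x₁ t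
  have hqd : ∀ t ∈ Ioo t₀ t₁, HasDerivAt q (-(q t) ^ 2) t := by
    intro t ht
    have hL : x₂ t - x₁ t ≠ 0 := (sub_pos.2 (hord t ht)).ne'
    have hL' : x₁ t - x₂ t ≠ 0 := (sub_neg.2 (hord t ht)).ne
    have h := (((hFderiv (w t)).comp t (hw t ht)).sub ((hFderiv (v t)).comp t (hv t ht))).div
      ((hx₂ t ht).hasDerivAt.sub (hx₁ t ht).hasDerivAt) hL
    refine h.congr_deriv ?_
    have hcv := (hconv (v t)).ne'
    have hcw := (hconv (w t)).ne'
    simp only [q, Function.comp, Pi.sub_apply]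
    rw [← neg_sub (x₂ t) (x₁ t)]
    field_simp
    ring
  have hrd : ∀ t ∈ Ioo t₀ t₁, HasDerivAt r (-(q t * r t)) t := by
    intro t ht
    have hL : x₂ t - x₁ t ≠ 0 := (sub_pos.2 (hord t ht)).ne'
    have h := ((hFderiv (v t)).comp t (hv t ht)).sub ((hqd t ht).mul (hx₁ t ht).hasDerivAt)
    refine h.congr_deriv ?_
    have hcv := (hconv (v t)).ne'
    simp only [r, q]
    field_simp
    ring
  have hqc : ContinuousOn q (Ioo t₀ t₁) := fun t ht =>
    (hqd t ht).continuousAt.continuousWithinAt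
  have hrc : ContinuousOn r (Ioo t₀ t₁) := fun t ht =>
    (hrd t ht).continuousAt.continuousWithinAt
  have hq1 : ContDiffOn ℝ 1 q (Ioo t₀ t₁) :=
    contDiffOn_one_of_hasDerivAt isOpen_Ioo hqd (hqc.pow 2).neg
  have hr1 : ContDiffOn ℝ 1 r (Ioo t₀ t₁) :=
    contDiffOn_one_of_hasDerivAt isOpen_Ioo hrd (hqc.mul hrc).neg
  have hFU : ∀ t ∈ Ioo t₀ t₁, ∀ x : ℝ, x₁ t < x → x < x₂ t →
      F (U x t) = q t * x + r t := by
    intro t ht x h₁ h₂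
    have hL : x₂ t - x₁ t ≠ 0 := (sub_pos.2 (hord t ht)).ne'
    have hD : F (w t) - F (v t) ≠ 0 :=
      sub_ne_zero.2 fun h => hvw t ht (hmono.injective h).symm
    have h := (hU t ht x h₁ h₂).2
    rw [div_eq_div_iff hL hD] at h
    simp only [r, q]
    field_simp
    linear_combination -h
  have hev : ∀ t ∈ Ioo t₀ t₁, ∀ x : ℝ, x₁ t < x → x < x₂ t →
      ∀ᶠ p : ℝ × ℝ in nhds (x, t), F (U p.1 p.2) = q p.2 * p.1 + r p.2 := by
    intro t ht x h₁ h₂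
    have hsnd : ContinuousAt (Prod.snd : ℝ × ℝ → ℝ) (x, t) := continuousAt_snd
    have hfst : ContinuousAt (Prod.fst : ℝ × ℝ → ℝ) (x, t) := continuousAt_fst
    have hc₁ : ContinuousAt (fun p : ℝ × ℝ => x₁ p.2) (x, t) :=
      ContinuousAt.comp (hx₁ t ht).continuousAt hsnd
    have hc₂ : ContinuousAt (fun p : ℝ × ℝ => x₂ p.2) (x, t) :=
      ContinuousAt.comp (hx₂ t ht).continuousAt hsnd
    filter_upwards [hsnd.eventually (isOpen_Ioo.mem_nhds ht), hc₁.eventually_lt hfst h₁,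
      hfst.eventually_lt hc₂ h₂] with p hp h₁ h₂
    exact hFU p.2 hp p.1 h₁ h₂
  have hUC : ∀ t ∈ Ioo t₀ t₁, ∀ x : ℝ, x₁ t < x → x < x₂ t →
      ContDiffAt ℝ 1 (fun p : ℝ × ℝ => U p.1 p.2) (x, t) := by
    intro t ht x h₁ h₂
    have hmem := isOpen_Ioo.mem_nhds ht
    have hqp : ContDiffAt ℝ 1 (fun p : ℝ × ℝ => q p.2) (x, t) :=
      ContDiffAt.comp (x, t) (hq1.contDiffAt hmem) contDiffAt_snd
    have hrp : ContDiffAt ℝ 1 (fun p : ℝ × ℝ => r p.2) (x, t) :=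
      ContDiffAt.comp (x, t) (hr1.contDiffAt hmem) contDiffAt_snd
    exact contDiffAt_of_comp_eventuallyEq hF hmono.injective (hconv _).ne'
      ((hqp.mul contDiffAt_fst).add hrp) (hev t ht x h₁ h₂)
  refine ⟨fun p hp => (hUC p.2 hp.1 p.1 hp.2.1 hp.2.2).contDiffWithinAt, ?_⟩
  intro t ht x h₁ h₂
  have hUd := (hUC t ht x h₁ h₂).differentiableAt one_ne_zero
  have hUt : DifferentiableAt ℝ (fun s => U x s) t :=
    DifferentiableAt.comp (g := fun p : ℝ × ℝ => U p.1 p.2) (f := fun s => (x, s)) t hUd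
      (by fun_prop)
  have hUx : DifferentiableAt ℝ (fun y => U y t) x :=
    DifferentiableAt.comp (g := fun p : ℝ × ℝ => U p.1 p.2) (f := fun y => (y, t)) x hUd
      (by fun_prop)
  have ht' : deriv F (U x t) * deriv (fun s => U x s) t = -(q t) ^ 2 * x + -(q t * r t) := by
    refine (HasDerivAt.comp t (hFderiv (U x t)) hUt.hasDerivAt).unique ?_
    refine (((hqd t ht).mul_const x).add (hrd t ht)).congr_of_eventuallyEq ?_
    exact (Continuous.prodMk_right x).continuousAt.eventually (hev t ht x h₁ h₂)
  have hx' : deriv F (U x t) * deriv (fun y => U y t) x = q t := by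
    refine (HasDerivAt.comp x (hFderiv (U x t)) hUx.hasDerivAt).unique ?_
    have h := (((hasDerivAt_id x).const_mul (q t)).add_const (r t))
    rw [mul_one] at h
    refine h.congr_of_eventuallyEq ?_
    exact (Continuous.prodMk_left t).continuousAt.eventually (hev t ht x h₁ h₂)
  refine mul_left_cancel₀ (hconv (U x t)).ne' ?_
  have hval := hFU t ht x h₁ h₂
  linear_combination ht' + F (U x t) * hx' + q t * hval
end

section
/- Let f : ℝ → ℝ be twice continuously differentiable with f''(u) > 0 for all u, and let s(u, v) = (f(u) - f(v))/(u - v) for u ≠ v, s(u, u) = f'(u). Suppose at some time t the quantities satisfy xᵢ < x₍ᵢ₊₁₎, the entropy conditions f'(uᵢ⁻) ≥ f'(uᵢ⁺) and f'(u₍ᵢ₊₁₎⁻) ≥ f'(u₍ᵢ₊₁₎⁺), and the rates u̇ᵢ⁺ = (s(uᵢ⁻, uᵢ⁺) - f'(uᵢ⁺))·(f'(u₍ᵢ₊₁₎⁻) - f'(uᵢ⁺))/((x₍ᵢ₊₁₎ - xᵢ)·f''(uᵢ⁺)) and u̇₍ᵢ₊₁₎⁻ = (s(u₍ᵢ₊₁₎⁻,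 u₍ᵢ₊₁₎⁺) - f'(u₍ᵢ₊₁₎⁻))·(f'(uᵢ⁺) - f'(u₍ᵢ₊₁₎⁻))/((xᵢ - x₍ᵢ₊₁₎)·f''(u₍ᵢ₊₁₎⁻)). Then (u̇₍ᵢ₊₁₎⁻ - u̇ᵢ⁺)·(u₍ᵢ₊₁₎⁻ - uᵢ⁺) ≤ 0; that is, the rate of change of the difference u₍ᵢ₊₁₎⁻ - uᵢ⁺ always has the opposite sign to (or the same zero value as) the difference itself, so the squared difference (u₍ᵢ₊₁₎⁻ - uᵢ⁺)² is non-increasing along the shock-particle evolution. -/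
/-- For a differentiable flux with monotone derivative, the shock speed lies between the
characteristic speeds of the two states. -/
theorem shockSpeed_mem_Icc {f : ℝ → ℝ} (hf : Differentiable ℝ f) (hmono : Monotone (deriv f))
    {u v : ℝ} (hvu : v ≤ u) : shockSpeed f u v ∈ Set.Icc (deriv f v) (deriv f u) := by
  rcases hvu.eq_or_lt with rfl | hlt
  · simp [shockSpeed]
  · obtain ⟨c, hc, hslope⟩ := exists_deriv_eq_slope f hlt hf.continuous.continuousOn
      hf.differentiableOn
    rw [shockSpeed, if_neg hlt.ne', ← hslope]
    exact ⟨hmono hc.1.le, hmono hc.2.le⟩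

/-- Sign property in the proof of Lemma 4.2: the rate of
change of the difference `u₍ᵢ₊₁₎⁻ - uᵢ⁺` along the shock-particle evolution
has the opposite sign to the difference itself, so the squared difference is
non-increasing. -/
theorem shock_particle_gap_sign
    (f : ℝ → ℝ) (hf : ContDiff ℝ 2 f) (hconv : ∀ u, 0 < deriv (deriv f) u)
    (xi xip uim uip ujm ujp : ℝ) (hx : xi < xip)
    (hent₁ : deriv f uip ≤ deriv f uim)
    (hent₂ : deriv f ujp ≤ deriv f ujm) :
    ((shockSpeed f ujm ujp - deriv f ujm) *
        ((deriv f uip - deriv f ujm) / ((xi - xip) * deriv (deriv f) ujm)) -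
      (shockSpeed f uim uip - deriv f uip) *
        ((deriv f ujm - deriv f uip) / ((xip - xi) * deriv (deriv f) uip))) *
      (ujm - uip) ≤ 0 := by
  have hmono : StrictMono (deriv f) := strictMono_of_deriv_pos hconv
  have hdiff : Differentiable ℝ f := hf.differentiable (by norm_num)
  have hi := (shockSpeed_mem_Icc hdiff hmono.monotone (hmono.le_iff_le.1 hent₁)).1
  have hj := (shockSpeed_mem_Icc hdiff hmono.monotone (hmono.le_iff_le.1 hent₂)).2
  have hgap : 0 ≤ (deriv f ujm - deriv f uip) * (ujm - uip) := by
    rcases le_total uip ujm with h | h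
    · exact mul_nonneg (sub_nonneg.2 (hmono.monotone h)) (sub_nonneg.2 h)
    · exact mul_nonneg_of_nonpos_of_nonpos (sub_nonpos.2 (hmono.monotone h)) (sub_nonpos.2 h)
  have hratio (w : ℝ) :
      0 ≤ (deriv f ujm - deriv f uip) * (ujm - uip) / ((xip - xi) * deriv (deriv f) w) :=
    div_nonneg hgap (mul_nonneg (sub_nonneg.2 hx.le) (hconv w).le)
  have hflip : (deriv f uip - deriv f ujm) / ((xi - xip) * deriv (deriv f) ujm) =
      (deriv f ujm - deriv f uip) / ((xip - xi) * deriv (deriv f) ujm) := by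
    rw [← neg_div_neg_eq, neg_sub, ← neg_mul, neg_sub]
  rw [hflip]
  have hleft := mul_nonneg (sub_nonneg.2 hi) (hratio uip)
  have hright := mul_nonpos_of_nonpos_of_nonneg (sub_nonpos.2 hj) (hratio ujm)
  rw [mul_div_right_comm] at hleft hright
  linarith
end

section
/- Let f : ℝ → ℝ be twice continuously differentiable with f''(u) > 0 for all u. Let x₁ < x₂ and u₁ ≠ u₂, and let U : [x₁, x₂] → ℝ be the similarity interpolant, i.e. the unique function with values between u₁ and u₂ satisfying (x - x₁)/(x₂ - x₁) = (f'(U(x)) - f'(u₁))/(f'(u₂) - f'(u₁)). Then ∫_{x₁}^{x₂} U(x) dx = (x₂ - x₁)·((f'(u₂)·u₂ - f(u₂)) - (f'(u₁)·u₁ - f(u₁)))/(f'(u₂) - f'(u₁)). -/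
open Set

/-- The integral of `u * f''(u)` is the increment of `f'(u) * u - f(u)`. -/
theorem integral_mul_deriv_deriv {f : ℝ → ℝ} (hf : ContDiff ℝ 2 f) (a b : ℝ) :
    ∫ u in a..b, deriv (deriv f) u * u =
      (deriv f b * b - f b) - (deriv f a * a - f a) := by
  have hf' : ContDiff ℝ 1 (deriv f) := ((contDiff_succ_iff_deriv (n := 1)).1 hf).2.2
  have hc : Continuous (deriv (deriv f)) := hf'.continuous_deriv le_rfl
  refine intervalIntegral.integral_eq_sub_of_hasDerivAt
    (f := fun u => deriv f u * u - f u) (fun u _ => ?_)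
    ((hc.mul continuous_id).intervalIntegrable a b)
  have h₁ := ((hf'.differentiable one_ne_zero) u).hasDerivAt
  have h₂ := ((hf.differentiable two_ne_zero) u).hasDerivAt
  exact ((h₁.mul (hasDerivAt_id' u)).sub h₂).congr_deriv (by ring)

/-- The area under the similarity interpolant:
`∫ U = (x₂ - x₁)·a(u₁, u₂)` where
`a(v, w) = [f'(u)·u - f(u)]_v^w / [f'(u)]_v^w` is a nonlinear average. -/
theorem similarity_interpolant_area
    (f : ℝ → ℝ) (hf : ContDiff ℝ 2 f) (hconv : ∀ u, 0 < deriv (deriv f) u)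
    (x₁ x₂ u₁ u₂ : ℝ) (hx : x₁ < x₂) (hu : u₁ ≠ u₂)
    (U : ℝ → ℝ)
    (hU : ∀ x ∈ Icc x₁ x₂,
      U x ∈ uIcc u₁ u₂ ∧
        (x - x₁) / (x₂ - x₁) =
          (deriv f (U x) - deriv f u₁) / (deriv f u₂ - deriv f u₁)) :
    ∫ x in x₁..x₂, U x =
      (x₂ - x₁) *
        (((deriv f u₂ * u₂ - f u₂) - (deriv f u₁ * u₁ - f u₁)) /
          (deriv f u₂ - deriv f u₁)) := by
  have hf' : ContDiff ℝ 1 (deriv f) := ((contDiff_succ_iff_deriv (n := 1)).1 hf).2.2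
  have hmono : StrictMono (deriv f) := strictMono_of_deriv_pos hconv
  have hL : 0 < x₂ - x₁ := sub_pos.2 hx
  have hD : deriv f u₂ - deriv f u₁ ≠ 0 := sub_ne_zero.2 (hmono.injective.ne hu.symm)
  set c := (x₂ - x₁) / (deriv f u₂ - deriv f u₁) with hc
  have hc0 : c ≠ 0 := div_ne_zero hL.ne' hD
  have hcD : c * (deriv f u₂ - deriv f u₁) = x₂ - x₁ := div_mul_cancel₀ _ hD
  let g : ℝ → ℝ := fun u => x₁ + c * (deriv f u - deriv f u₁)
  have hg_inj : Function.Injective g := fun a b hab =>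
    hmono.injective (by simpa [g, hc0] using hab)
  have hg_deriv (u : ℝ) : HasDerivAt g (c * deriv (deriv f) u) u :=
    ((((hf'.differentiable one_ne_zero) u).hasDerivAt.sub_const _).const_mul c).const_add x₁
  have hgU : ∀ x ∈ Icc x₁ x₂, g (U x) = x := by
    intro x hxI
    have h := (hU x hxI).2
    have hL' := hL.ne'
    rw [div_eq_div_iff hL' hD] at h
    simp only [g, hc]
    field_simp
    linarith
  have hg_mem : ∀ u ∈ uIcc u₁ u₂, g u ∈ Icc x₁ x₂ := by
    intro u hu'
    have h := hmono.monotone.mapsTo_uIcc hu'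
    have hg₁ : x₁ + c * (deriv f u₁ - deriv f u₁) = x₁ := by ring
    have hg₂ : x₁ + c * (deriv f u₂ - deriv f u₁) = x₂ := by rw [hcD]; ring
    simp only [g]
    rcases lt_or_gt_of_ne hu with hlt | hlt
    · have hd := hmono hlt
      rw [uIcc_of_le hd.le] at h
      have hcp : 0 < c := div_pos hL (sub_pos.2 hd)
      constructor <;> nlinarith [h.1, h.2]
    · have hd := hmono hlt
      rw [uIcc_of_ge hd.le] at h
      have hcn : c < 0 := div_neg_of_pos_of_neg hL (sub_neg.2 hd)
      constructor <;> nlinarith [h.1, h.2]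
  have himage : g '' uIcc u₁ u₂ = Icc x₁ x₂ :=
    Subset.antisymm (image_subset_iff.2 hg_mem) fun x hxI => ⟨U x, (hU x hxI).1, hgU x hxI⟩
  have hUg : ∀ u ∈ uIcc u₁ u₂, U (g u) = u := fun u hu' =>
    hg_inj (hgU _ (hg_mem u hu'))
  have hcov : ∫ x in x₁..x₂, U x = ∫ u in uIcc u₁ u₂, |c| * (deriv (deriv f) u * u) := by
    rw [intervalIntegral.integral_of_le hx.le, ← MeasureTheory.integral_Icc_eq_integral_Ioc,
      ← himage, MeasureTheory.integral_image_eq_integral_abs_deriv_smul measurableSet_uIcc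
        (fun u _ => (hg_deriv u).hasDerivWithinAt) hg_inj.injOn]
    refine MeasureTheory.setIntegral_congr_fun measurableSet_uIcc fun u hu' => ?_
    simp only [hUg u hu', smul_eq_mul, abs_mul, abs_of_pos (hconv u), mul_assoc]
  have hI := integral_mul_deriv_deriv hf u₁ u₂
  rw [hcov, MeasureTheory.integral_const_mul, ← hI, mul_div_left_comm, mul_comm _ (_ / _), ← hc]
  rcases lt_or_gt_of_ne hu with hlt | hlt
  · have hcp : 0 < c := div_pos hL (sub_pos.2 (hmono hlt))
    rw [abs_of_pos hcp, uIcc_of_le hlt.le, intervalIntegral.integral_of_le hlt.le,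
      MeasureTheory.integral_Icc_eq_integral_Ioc]
  · have hcn : c < 0 := div_neg_of_pos_of_neg hL (sub_neg.2 (hmono hlt))
    rw [abs_of_neg hcn, uIcc_of_ge hlt.le, intervalIntegral.integral_of_ge hlt.le,
      MeasureTheory.integral_Icc_eq_integral_Ioc, neg_mul, mul_neg]
end

section
/- Let f : ℝ → ℝ be twice continuously differentiable with f''(u) > 0 for all u, let u₁ < u₂ (so that f'(u₁) < f'(u₂)), and let x₀ ∈ ℝ. For t > 0, put x₁(t) = x₀ + f'(u₁)·t and x₂(t) = x₀ + f'(u₂)·t, and for x ∈ [x₁(t), x₂(t)] define U(x, t) as the unique value in [u₁, u₂] with (x - x₁(t))/(x₂(t) - x₁(t)) = (f'(U(x,t)) - f'(u₁))/(f'(u₂) - f'(u₁)). Then for all t > 0 and x ∈ [x₁(t), x₂(t)] one has f'(U(x, t)) = (x - x₀)/t; consequently U is the centered rarefaction wave emanating from x₀, and it satisfies ∂U/∂t + f'(U)·∂U/∂x = 0 at every point with t > 0 and x₁(t) < x < x₂(t). -/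
open Set

/-- If `g` is injective with nonzero strict derivative and `g ∘ V` agrees with a differentiable
`c` near `t`, then `V` is differentiable at `t`. -/
theorem HasStrictDerivAt.hasDerivAt_of_comp_eventuallyEq {g V c : ℝ → ℝ} {g' c' t : ℝ}
    (hg : HasStrictDerivAt g g' (V t)) (hg' : g' ≠ 0) (hinj : Function.Injective g)
    (hc : HasDerivAt c c' t) (h : ∀ᶠ s in nhds t, g (V s) = c s) :
    HasDerivAt V (g'⁻¹ * c') t := by
  have hct : c t = g (V t) := h.self_of_nhds.symm
  have hinv : HasDerivAt (hg.localInverse g g' (V t) hg') g'⁻¹ (c t) :=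
    hct ▸ (hg.to_localInverse hg').hasDerivAt
  have hright : ∀ᶠ y in nhds (c t), g (hg.localInverse g g' (V t) hg' y) = y :=
    hct ▸ (hg.hasStrictFDerivAt_equiv hg').eventually_right_inverse
  refine (hinv.comp t hc).congr_of_eventuallyEq ?_
  filter_upwards [h, hc.continuousAt.eventually hright] with s hs hs'
  exact hinj (hs.trans hs'.symm)

/-- An entropy-violating discontinuity at `x₀` between
states `u₁ < u₂` immediately becomes a centered rarefaction wave: the
similarity interpolant between the two departing characteristic particles
`x₀ + f'(u₁)·t` and `x₀ + f'(u₂)·t` satisfies `f'(U(x, t)) = (x - x₀)/t` and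
solves `∂U/∂t + f'(U)·∂U/∂x = 0` for `t > 0`. -/
theorem entropy_violating_jump_becomes_rarefaction
    (f : ℝ → ℝ) (hf : ContDiff ℝ 2 f) (hconv : ∀ u, 0 < deriv (deriv f) u)
    (u₁ u₂ x₀ : ℝ) (hu : u₁ < u₂)
    (U : ℝ → ℝ → ℝ)
    (hU : ∀ t : ℝ, 0 < t →
      ∀ x ∈ Icc (x₀ + deriv f u₁ * t) (x₀ + deriv f u₂ * t),
        U x t ∈ Icc u₁ u₂ ∧
          (x - (x₀ + deriv f u₁ * t)) /
              ((x₀ + deriv f u₂ * t) - (x₀ + deriv f u₁ * t)) =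
            (deriv f (U x t) - deriv f u₁) / (deriv f u₂ - deriv f u₁)) :
    (∀ t : ℝ, 0 < t →
      ∀ x ∈ Icc (x₀ + deriv f u₁ * t) (x₀ + deriv f u₂ * t),
        deriv f (U x t) = (x - x₀) / t) ∧
    (∀ t : ℝ, 0 < t → ∀ x : ℝ,
      x₀ + deriv f u₁ * t < x → x < x₀ + deriv f u₂ * t →
      deriv (fun s => U x s) t + deriv f (U x t) * deriv (fun y => U y t) x = 0) := by
  have hg : ContDiff ℝ 1 (deriv f) := (contDiff_succ_iff_deriv (n := 1)).1 hf |>.2.2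
  have hmono : StrictMono (deriv f) := strictMono_of_deriv_pos hconv
  have hlt := hmono hu
  have speed : ∀ t : ℝ, 0 < t →
      ∀ x ∈ Icc (x₀ + deriv f u₁ * t) (x₀ + deriv f u₂ * t),
        deriv f (U x t) = (x - x₀) / t := by
    intro t ht x hx
    have h := (hU t ht x hx).2
    have hd : deriv f u₂ - deriv f u₁ ≠ 0 := (sub_pos.2 hlt).ne'
    rw [show x₀ + deriv f u₂ * t - (x₀ + deriv f u₁ * t) =
      t * (deriv f u₂ - deriv f u₁) by ring, ← div_div, div_left_inj' hd, div_eq_iff ht.ne'] at h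
    rw [eq_div_iff ht.ne']
    linarith
  refine ⟨speed, fun t ht x hx₁ hx₂ => ?_⟩
  have hstrict : HasStrictDerivAt (deriv f) (deriv (deriv f) (U x t)) (U x t) :=
    hg.contDiffAt.hasStrictDerivAt one_ne_zero
  have hne := (hconv (U x t)).ne'
  have htime : ∀ᶠ s in nhds t, deriv f (U x s) = (x - x₀) / s := by
    have h₁ : ∀ᶠ s in nhds t, x₀ + deriv f u₁ * s < x :=
      ContinuousAt.eventually_lt (by fun_prop) continuousAt_const hx₁
    have h₂ : ∀ᶠ s in nhds t, x < x₀ + deriv f u₂ * s :=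
      ContinuousAt.eventually_lt continuousAt_const (by fun_prop) hx₂
    filter_upwards [h₁, h₂, lt_mem_nhds ht] with s hs₁ hs₂ hs
    exact speed s hs x ⟨hs₁.le, hs₂.le⟩
  have hspace : ∀ᶠ y in nhds x, deriv f (U y t) = (y - x₀) / t := by
    filter_upwards [lt_mem_nhds hx₁, gt_mem_nhds hx₂] with y hy₁ hy₂
    exact speed t ht y ⟨hy₁.le, hy₂.le⟩
  have hct : HasDerivAt (fun s => (x - x₀) / s) (-(x - x₀) / t ^ 2) t := by
    simpa using (hasDerivAt_const t (x - x₀)).fun_div (hasDerivAt_id t) ht.ne'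
  have hcx : HasDerivAt (fun y => (y - x₀) / t) (1 / t) x :=
    ((hasDerivAt_id x).sub_const x₀).div_const t
  rw [(HasStrictDerivAt.hasDerivAt_of_comp_eventuallyEq (V := fun s => U x s) hstrict hne
      hmono.injective hct htime).deriv,
    (HasStrictDerivAt.hasDerivAt_of_comp_eventuallyEq (V := fun y => U y t) hstrict hne
      hmono.injective hcx hspace).deriv, speed t ht x ⟨hx₁.le, hx₂.le⟩]
  field_simp
  ring
end
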